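/- arXiv:1407.6947 — 16 statements merged into one kernel-verified Lean document; each statement's English description precedes it below -/
import Mathlib

section
/- Every minimizer N* of g over ℕ satisfies 2αY − 3/2 ≤ N* ≤ 2αY + 3/2. More precisely, every even minimizer N* satisfies 2αY − 3/2 ≤ N* ≤ 2αY + 1/2 and every odd minimizer N* satisfies 2αY − 1 ≤ N* ≤ 2αY. -/
/-- Every minimizer `N*` of `g` over `ℕ` satisfies `2αY − 3/2 ≤ N* ≤ 2αY + 3/2`;
every even minimizer satisfies `2αY − 3/2 ≤ N* ≤ 2αY + 1/2` and every odd minimizer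
satisfies `2αY − 1 ≤ N* ≤ 2αY`. -/
theorem stmt_1 (α γ δ Y : ℝ) (hα : 0 < α) (hγ : 0 < γ) (hδ : 0 ≤ δ) (hY : 0 < Y)
    (g : ℕ → ℝ)
    (hg : ∀ N : ℕ, g N = if Even N then -2*α*N + N*(N+1)/(2*Y)
      else -2*α*N + δ*γ/Y + N*(N+1)/(2*Y))
    (Nstar : ℕ) (hmin : ∀ M : ℕ, g Nstar ≤ g M) :
    (2*α*Y - 3/2 ≤ (Nstar : ℝ) ∧ (Nstar : ℝ) ≤ 2*α*Y + 3/2) ∧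
    (Even Nstar → 2*α*Y - 3/2 ≤ (Nstar : ℝ) ∧ (Nstar : ℝ) ≤ 2*α*Y + 1/2) ∧
    (Odd Nstar → 2*α*Y - 1 ≤ (Nstar : ℝ) ∧ (Nstar : ℝ) ≤ 2*α*Y) := by
  have hδγ : 0 ≤ δ * γ := by positivity
  have mul_even : ∀ N : ℕ, Even N → Y * g N = -(2*α*Y)*N + N*(N+1)/2 := by
    intro N hN
    rw [hg, if_pos hN]
    field_simp
  have mul_odd : ∀ N : ℕ, Odd N → Y * g N = -(2*α*Y)*N + δ*γ + N*(N+1)/2 := by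
    intro N hN
    rw [hg, if_neg (Nat.not_even_iff_odd.mpr hN)]
    field_simp
  have mul_min : ∀ M : ℕ, Y * g Nstar ≤ Y * g M := fun M =>
    mul_le_mul_of_nonneg_left (hmin M) hY.le
  have h_even : Even Nstar →
      2*α*Y - 3/2 ≤ (Nstar : ℝ) ∧ (Nstar : ℝ) ≤ 2*α*Y + 1/2 := by
    intro hN
    constructor
    · have h := mul_min (Nstar + 2)
      rw [mul_even _ hN, mul_even _ (by grind)] at h
      push_cast at h
      linarith
    · rcases Nat.eq_zero_or_pos Nstar with h0 | hpos
      · rw [h0]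
        push_cast
        positivity
      · obtain ⟨M, rfl⟩ : ∃ M, Nstar = M + 2 := ⟨Nstar - 2, by grind⟩
        have h := mul_min M
        rw [mul_even _ hN, mul_even _ (by grind)] at h
        push_cast at h ⊢
        linarith
  have h_odd : Odd Nstar → 2*α*Y - 1 ≤ (Nstar : ℝ) ∧ (Nstar : ℝ) ≤ 2*α*Y := by
    intro hN
    constructor
    · have h := mul_min (Nstar + 1)
      rw [mul_odd _ hN, mul_even _ (by grind)] at h
      push_cast at h
      linarith
    · obtain ⟨M, rfl⟩ : ∃ M, Nstar = M + 1 := ⟨Nstar - 1, by grind⟩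
      have h := mul_min M
      rw [mul_odd _ hN, mul_even _ (by grind)] at h
      push_cast at h ⊢
      linarith
  refine ⟨?_, h_even, h_odd⟩
  rcases Nat.even_or_odd Nstar with hN | hN
  · obtain ⟨h₁, h₂⟩ := h_even hN
    constructor <;> linarith
  · obtain ⟨h₁, h₂⟩ := h_odd hN
    constructor <;> linarith
end

section
/- If Y > 0 and Y ∉ S_δ, then g has a unique minimizer over ℕ, i.e. there exists N* ∈ ℕ with g(N*) < g(M) for all M ∈ ℕ, M ≠ N*. -/
/-- For an integer `p ≠ 0` and `t` in the open interval `(-3/2, 1/2)`, the even-step increment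
`2p(2p + 1 + 2t)` is positive. -/
theorem even_increment_pos {p : ℤ} {t : ℝ} (hp : p ≠ 0) (h1 : -(3 / 2) < t) (h2 : t < 1 / 2) :
    0 < (2 * p : ℝ) * (2 * p + 1 + 2 * t) := by
  rcases lt_or_gt_of_ne hp with h | h
  · have h' : (p : ℝ) ≤ -1 := by exact_mod_cast (by omega : p ≤ -1)
    exact mul_pos_of_neg_of_neg (by linarith) (by linarith)
  · have h' : (1 : ℝ) ≤ p := by exact_mod_cast h
    exact mul_pos (by linarith) (by linarith)

/-- An odd-step increment from an even point, with penalty `2d` at odd points. -/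
theorem odd_increment_add_pos {p : ℤ} {t d : ℝ} (hd : 0 ≤ d)
    (h1 : -1 - min d (1 / 2) < t) (h2 : t < min d (1 / 2)) :
    0 < (2 * p + 1 : ℝ) * (2 * p + 2 + 2 * t) + 2 * d := by
  have hC := min_le_left d (1 / 2)
  have hC' := min_le_right d (1 / 2)
  rcases (by omega : p = 0 ∨ p = -1 ∨ 1 ≤ p ∨ p ≤ -2) with rfl | rfl | h | h
  · push_cast; linarith
  · push_cast; linarith
  · have h' : (1 : ℝ) ≤ p := by exact_mod_cast h
    have := mul_pos (a := (2 * p + 1 : ℝ)) (b := 2 * p + 2 + 2 * t) (by linarith) (by linarith)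
    linarith
  · have h' : (p : ℝ) ≤ -2 := by exact_mod_cast h
    have := mul_pos_of_neg_of_neg (a := (2 * p + 1 : ℝ)) (b := 2 * p + 2 + 2 * t)
      (by linarith) (by linarith)
    linarith

/-- An odd-step increment from an odd point, with penalty `2d` at odd points. -/
theorem odd_increment_sub_pos {p : ℤ} {t d : ℝ} (hd : 0 ≤ d)
    (h1 : -1 + min d (1 / 2) < t) (h2 : t < -min d (1 / 2)) :
    0 < (2 * p + 1 : ℝ) * (2 * p + 2 + 2 * t) - 2 * d := by
  have hd2 : d < 1 / 2 := by
    by_contra! h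
    rw [min_eq_right h] at h1 h2
    linarith
  rw [min_eq_left hd2.le] at h1 h2
  rcases (by omega : p = 0 ∨ p = -1 ∨ 1 ≤ p ∨ p ≤ -2) with rfl | rfl | h | h
  · push_cast; linarith
  · push_cast; linarith
  · have h' : (1 : ℝ) ≤ p := by exact_mod_cast h
    nlinarith
  · have h' : (p : ℝ) ≤ -2 := by exact_mod_cast h
    nlinarith

/-- If `Y > 0` and `Y ∉ S_δ`, then `g` has a unique minimizer over `ℕ`. -/
theorem stmt_2 (α γ δ Y : ℝ) (hα : 0 < α) (hγ : 0 < γ) (hδ : 0 ≤ δ) (hY : 0 < Y)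
    (g : ℕ → ℝ)
    (hg : ∀ N : ℕ, g N = if Even N then -2*α*N + N*(N+1)/(2*Y)
      else -2*α*N + δ*γ/Y + N*(N+1)/(2*Y))
    (hS : Y ∉ ({x : ℝ | ∃ m : ℤ, x = (2*m + 1 + min (δ*γ) (1/2))/(2*α)} ∪
      {x : ℝ | ∃ m : ℤ, x = (2*m - min (δ*γ) (1/2))/(2*α)})) :
    ∃ Nstar : ℕ, ∀ M : ℕ, M ≠ Nstar → g Nstar < g M := by
  have hd : 0 ≤ δ * γ := by positivity
  have hC0 : 0 ≤ min (δ * γ) (1 / 2) := le_min hd (by norm_num)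
  have hC1 := min_le_right (δ * γ) (1 / 2)
  simp only [Set.mem_union, Set.mem_ofPred_eq, not_or, not_exists] at hS
  obtain ⟨hS1, hS2⟩ := hS
  have hne1 (m : ℤ) : 2 * α * Y ≠ 2 * m + 1 + min (δ * γ) (1 / 2) := fun h =>
    hS1 m (by rw [← h]; field_simp)
  have hne2 (m : ℤ) : 2 * α * Y ≠ 2 * m - min (δ * γ) (1 / 2) := fun h =>
    hS2 m (by rw [← h]; field_simp)
  have hy : 0 < 2 * α * Y := by positivity
  have heven (a : ℕ) : g (2 * a) = (2 * a * (2 * a + 1 - 2 * (2 * α * Y))) / (2 * Y) := by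
    rw [hg, if_pos (even_two_mul a)]
    push_cast
    field_simp
    ring
  have hodd (a : ℕ) : g (2 * a + 1) =
      ((2 * a + 1) * (2 * a + 2 - 2 * (2 * α * Y)) + 2 * (δ * γ)) / (2 * Y) := by
    rw [hg, if_neg (by simp)]
    push_cast
    field_simp
    ring
  generalize 2 * α * Y = y at *
  generalize δ * γ = d at *
  have hfl := Nat.floor_le (a := (y + min d (1 / 2)) / 2) (by linarith)
  have hlt := Nat.lt_floor_add_one ((y + min d (1 / 2)) / 2)
  generalize ⌊(y + min d (1 / 2)) / 2⌋₊ = k at *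
  have hk : 2 * k - min d (1 / 2) < y :=
    lt_of_le_of_ne (by linarith) (by simpa using (hne2 k).symm)
  have hk2 : y < 2 * k + 2 - min d (1 / 2) := by linarith
  rcases lt_or_gt_of_ne (hne1 k) with h | h <;> push_cast at h
  · refine ⟨2 * k, fun M hM => ?_⟩
    obtain ⟨a, rfl | rfl⟩ := M.even_or_odd'
    · have := even_increment_pos (p := (a : ℤ) - k) (t := 2 * k - y) (by omega)
        (by linarith) (by linarith)
      rw [heven, heven]
      push_cast at this
      gcongr ?_ / _
      linarith
    · have := odd_increment_add_pos (p := (a : ℤ) - k) (t := 2 * k - y) hd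
        (by linarith) (by linarith)
      rw [heven, hodd]
      push_cast at this
      gcongr ?_ / _
      linarith
  · refine ⟨2 * k + 1, fun M hM => ?_⟩
    obtain ⟨a, rfl | rfl⟩ := M.even_or_odd'
    · have := odd_increment_sub_pos (p := (a : ℤ) - k - 1) (t := 2 * k + 1 - y) hd
        (by linarith) (by linarith)
      rw [heven, hodd]
      push_cast at this
      gcongr ?_ / _
      linarith
    · have := even_increment_pos (p := (a : ℤ) - k) (t := 2 * k + 1 - y) (by omega)
        (by linarith) (by linarith)
      rw [hodd, hodd]
      push_cast at this
      gcongr ?_ / _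
      linarith
end

section
/- Assume 0 ≤ δγ < 1/2. Then the minimum problem min{g(N) : N ∈ ℕ} fails to have a unique solution if and only if Y ∈ S_δ; that is, there exist two distinct minimizers of g over ℕ exactly when Y belongs to the singular set S_δ. -/
/-- A sequence with monotone increments has two distinct minimizers iff some increment vanishes. -/
theorem exists_ne_minimizers_iff {u d : ℕ → ℝ} (hd : Monotone d)
    (hu : ∀ n, u (n + 1) = u n + d n) :
    (∃ N₁ N₂ : ℕ, N₁ ≠ N₂ ∧ (∀ M : ℕ, u N₁ ≤ u M) ∧ (∀ M : ℕ, u N₂ ≤ u M)) ↔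
      ∃ n, d n = 0 := by
  constructor
  · have key : ∀ N₁ N₂ : ℕ, N₁ < N₂ → (∀ M : ℕ, u N₁ ≤ u M) → (∀ M : ℕ, u N₂ ≤ u M) →
        ∃ n, d n = 0 := by
      intro N₁ N₂ hlt h₁ h₂
      obtain ⟨k, rfl⟩ : ∃ k, N₂ = k + 1 := ⟨N₂ - 1, by omega⟩
      have hmono := hd (show N₁ ≤ k by omega)
      have hleft := h₁ (N₁ + 1)
      have hright := h₂ k
      rw [hu] at hleft hright
      exact ⟨N₁, by linarith⟩
    rintro ⟨N₁, N₂, hne, h₁, h₂⟩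
    rcases hne.lt_or_gt with h | h
    · exact key N₁ N₂ h h₁ h₂
    · exact key N₂ N₁ h h₂ h₁
  · rintro ⟨n, hn⟩
    have hup : ∀ k, u n ≤ u (n + k) := by
      intro k
      induction k with
      | zero => exact le_rfl
      | succ k ih =>
        have hmono := hd (show n ≤ n + k by omega)
        rw [← add_assoc, hu]
        linarith
    have hdown : ∀ k M, M + k = n → u n ≤ u M := by
      intro k
      induction k with
      | zero => rintro M rfl; exact le_rfl
      | succ k ih =>
        intro M hM
        have hnext := ih (M + 1) (by omega)
        have hmono := hd (show M ≤ n by omega)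
        rw [hu] at hnext
        linarith
    have hmin : ∀ M, u n ≤ u M := by
      intro M
      rcases le_total n M with h | h
      · obtain ⟨k, rfl⟩ := Nat.exists_eq_add_of_le h
        exact hup k
      · exact hdown (n - M) M (by omega)
    refine ⟨n, n + 1, by omega, hmin, fun M => ?_⟩
    rw [hu, hn, add_zero]
    exact hmin M

/-- For `0 ≤ δγ < 1/2`, the minimum problem `min {g(N) : N ∈ ℕ}` fails to have a
unique solution if and only if `Y ∈ S_δ`. -/
theorem stmt_3 (α γ δ Y : ℝ) (hα : 0 < α) (hγ : 0 < γ) (hδ : 0 ≤ δ) (hY : 0 < Y)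
    (hδγ : δ*γ < 1/2)
    (g : ℕ → ℝ)
    (hg : ∀ N : ℕ, g N = if Even N then -2*α*N + N*(N+1)/(2*Y)
      else -2*α*N + δ*γ/Y + N*(N+1)/(2*Y)) :
    (∃ N₁ N₂ : ℕ, N₁ ≠ N₂ ∧ (∀ M : ℕ, g N₁ ≤ g M) ∧ (∀ M : ℕ, g N₂ ≤ g M)) ↔
      Y ∈ ({x : ℝ | ∃ m : ℤ, x = (2*m + 1 + min (δ*γ) (1/2))/(2*α)} ∪
        {x : ℝ | ∃ m : ℤ, x = (2*m - min (δ*γ) (1/2))/(2*α)}) := by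
  have hc : 0 ≤ δ * γ := mul_nonneg hδ hγ.le
  rw [min_eq_left hδγ.le]
  have ht : 0 < Y * (2 * α) := by positivity
  set d : ℕ → ℝ := fun n =>
    ((n : ℝ) + 1 + (if Even n then δ * γ else -(δ * γ)) - Y * (2 * α)) / Y with hd_def
  have hd : Monotone d := by
    refine monotone_nat_of_le_succ fun n => ?_
    simp only [hd_def]
    refine div_le_div_of_nonneg_right ?_ hY.le
    push_cast
    split_ifs <;> linarith
  have hu : ∀ n, g (n + 1) = g n + d n := by
    intro n
    simp only [hg, hd_def, Nat.even_add_one]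
    by_cases h : Even n
    · simp only [h, not_true_eq_false, if_true, if_false]
      push_cast
      field_simp
      ring
    · simp only [h, not_false_eq_true, if_true, if_false]
      push_cast
      field_simp
      ring
  rw [exists_ne_minimizers_iff hd hu]
  simp only [Set.mem_union, Set.mem_ofPred_eq, eq_div_iff (show 2 * α ≠ 0 by positivity),
    hd_def, div_eq_zero_iff, hY.ne', or_false]
  constructor
  · rintro ⟨n, hn⟩
    rcases Nat.even_or_odd' n with ⟨k, rfl | rfl⟩
    · refine Or.inl ⟨k, ?_⟩
      simp only [even_two_mul, if_true] at hn
      push_cast at hn ⊢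
      linarith
    · refine Or.inr ⟨k + 1, ?_⟩
      simp only [Nat.even_add_one, even_two_mul, not_true_eq_false, if_false] at hn
      push_cast at hn ⊢
      linarith
  · rintro (⟨m, hm⟩ | ⟨m, hm⟩)
    · have hpos : (-1 : ℝ) < m := by linarith
      have hm0 : 0 ≤ m := by
        have : (-1 : ℤ) < m := by exact_mod_cast hpos
        omega
      lift m to ℕ using hm0
      refine ⟨2 * m, ?_⟩
      simp only [even_two_mul, if_true]
      push_cast at hm ⊢
      linarith
    · have hpos : (0 : ℝ) < m := by linarith
      have hm0 : 0 ≤ m - 1 := by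
        have : (0 : ℤ) < m := by exact_mod_cast hpos
        omega
      obtain ⟨k, hk⟩ := Int.eq_ofNat_of_zero_le hm0
      obtain rfl : m = k + 1 := by omega
      refine ⟨2 * k + 1, ?_⟩
      simp only [Nat.even_add_one, even_two_mul, not_true_eq_false, if_false]
      push_cast at hm ⊢
      linarith
end

section
/- Suppose δ ≥ 1/(2γ) (the supercritical regime). Then for every Y > 0 with Y ∉ S_δ, the unique minimizer of g over ℕ is an even integer. -/
/-- A point at distance less than `1` from an even integer is at distance more than `1` from
every other even integer. -/
lemma one_lt_sq_sub_of_even_ne {x : ℝ} {m n : ℕ} (hm : Even m) (hn : Even n) (hne : m ≠ n)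
    (hx : |(n : ℝ) - x| < 1) : 1 < ((m : ℝ) - x) ^ 2 := by
  obtain ⟨hl, hr⟩ := abs_lt.mp hx
  obtain ⟨a, rfl⟩ := hm
  obtain ⟨b, rfl⟩ := hn
  push_cast at hl hr ⊢
  rcases lt_or_gt_of_ne (show a ≠ b by lia) with h | h
  · have : (a : ℝ) + 1 ≤ b := by exact_mod_cast h
    nlinarith
  · have : (b : ℝ) + 1 ≤ a := by exact_mod_cast h
    nlinarith

/-- Every `x ≥ -1/2` that is not an odd integer lies at distance less than `1` from some even
natural number. -/
lemma exists_even_abs_sub_lt_one {x : ℝ} (hx : -1 / 2 ≤ x) (hodd : ∀ m : ℤ, x ≠ 2 * m - 1) :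
    ∃ n : ℕ, Even n ∧ |(n : ℝ) - x| < 1 := by
  have hle := Nat.floor_le (show 0 ≤ (x + 1) / 2 by linarith)
  have hlt := Nat.lt_floor_add_one ((x + 1) / 2)
  have hne := hodd (⌊(x + 1) / 2⌋₊ : ℕ)
  generalize ⌊(x + 1) / 2⌋₊ = k at hle hlt hne
  refine ⟨2 * k, even_two_mul k, ?_⟩
  push_cast at hne ⊢
  have : 2 * (k : ℝ) - 1 < x := lt_of_le_of_ne (by linarith) hne.symm
  rw [abs_lt]
  constructor <;> linarith


/-- In the supercritical regime `δ ≥ 1/(2γ)`, for every `Y > 0` outside the singular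
set `S_δ` the unique minimizer of `g` over `ℕ` is even. -/
theorem stmt_4 (α γ δ Y : ℝ) (hα : 0 < α) (hγ : 0 < γ) (hδ : 0 ≤ δ) (hY : 0 < Y)
    (hsup : 1/(2*γ) ≤ δ)
    (g : ℕ → ℝ)
    (hg : ∀ N : ℕ, g N = if Even N then -2*α*N + N*(N+1)/(2*Y)
      else -2*α*N + δ*γ/Y + N*(N+1)/(2*Y))
    (hS : Y ∉ ({x : ℝ | ∃ m : ℤ, x = (2*m + 1 + min (δ*γ) (1/2))/(2*α)} ∪
      {x : ℝ | ∃ m : ℤ, x = (2*m - min (δ*γ) (1/2))/(2*α)})) :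
    ∃ Nstar : ℕ, Even Nstar ∧ ∀ M : ℕ, M ≠ Nstar → g Nstar < g M := by
  have hc : 1 / 2 ≤ δ * γ := by
    rw [div_le_iff₀ (by positivity)] at hsup
    linarith
  obtain ⟨x, hx⟩ : ∃ x, x = 2 * α * Y - 1 / 2 := ⟨_, rfl⟩
  have hgE (N : ℕ) (hN : Even N) : g N = ((N - x) ^ 2 - x ^ 2) / (2 * Y) := by
    rw [hg, if_pos hN, hx]
    field_simp
    ring
  have hgO (N : ℕ) (hN : ¬ Even N) : g N = ((N - x) ^ 2 + 2 * (δ * γ) - x ^ 2) / (2 * Y) := by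
    rw [hg, if_neg hN, hx]
    field_simp
    ring
  have hodd (m : ℤ) : x ≠ 2 * m - 1 := by
    intro h
    refine hS (Or.inr ⟨m, ?_⟩)
    rw [min_eq_right hc, eq_div_iff (by positivity)]
    linarith
  have hx_ge : -1 / 2 ≤ x := by
    have : 0 < α * Y := mul_pos hα hY
    linarith
  obtain ⟨n, hn, hnx⟩ := exists_even_abs_sub_lt_one hx_ge hodd
  have hsq : ((n : ℝ) - x) ^ 2 < 1 := (sq_lt_one_iff_abs_lt_one _).mpr hnx
  refine ⟨n, hn, fun M hM => ?_⟩
  rw [hgE n hn]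
  by_cases hME : Even M
  · rw [hgE M hME]
    have := one_lt_sq_sub_of_even_ne hME hn hM hnx
    gcongr ?_ / _
    linarith
  · rw [hgO M hME]
    gcongr ?_ / _
    linarith [sq_nonneg ((M : ℝ) - x)]
end

section
/- Suppose δ < 1/(2γ) (the subcritical regime). Then for every odd N ∈ ℕ the open interval ((N+δγ)/(2α), (N+1−δγ)/(2α)) is nonempty, and for every Y in this interval the odd number N is the unique minimizer of g over ℕ. In particular, odd minimizers occur for suitable Y when and only when δ < 1/(2γ). -/
/-- If `|t| < 1 - 2c` with `c ≥ 0`, then `d (d - t) > 2c` for every nonzero integer `d`. -/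
lemma int_mul_sub_gt {d : ℤ} {c t : ℝ} (hd : d ≠ 0) (hc : 0 ≤ c) (h₁ : -(1 - 2 * c) < t)
    (h₂ : t < 1 - 2 * c) : 2 * c < d * (d - t) := by
  rcases lt_or_gt_of_ne hd with h | h
  · have hd' : (d : ℝ) ≤ -1 := by exact_mod_cast Int.le_sub_one_of_lt h
    nlinarith
  · have hd' : (1 : ℝ) ≤ d := by exact_mod_cast h
    nlinarith

/-- In the subcritical regime `δ < 1/(2γ)`, for every odd `N` the open interval
`((N+δγ)/(2α), (N+1−δγ)/(2α))` is nonempty, and for every `Y` in this interval the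
odd number `N` is the unique minimizer of `g_Y` over `ℕ`. -/
theorem stmt_5 (α γ δ : ℝ) (hα : 0 < α) (hγ : 0 < γ) (hδ : 0 ≤ δ)
    (hsub : δ < 1/(2*γ))
    (g : ℝ → ℕ → ℝ)
    (hg : ∀ Y : ℝ, ∀ N : ℕ, g Y N = if Even N then -2*α*N + N*(N+1)/(2*Y)
      else -2*α*N + δ*γ/Y + N*(N+1)/(2*Y)) :
    ∀ N : ℕ, Odd N →
      ((N : ℝ) + δ*γ)/(2*α) < ((N : ℝ) + 1 - δ*γ)/(2*α) ∧
      ∀ Y : ℝ, ((N : ℝ) + δ*γ)/(2*α) < Y → Y < ((N : ℝ) + 1 - δ*γ)/(2*α) →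
        ∀ M : ℕ, M ≠ N → g Y N < g Y M := by
  intro N hN
  have hc0 : 0 ≤ δ * γ := by positivity
  have hc : δ * γ < 1 / 2 := by
    rw [lt_div_iff₀ (by positivity)] at hsub
    linarith
  refine ⟨by gcongr; linarith, fun Y hY₁ hY₂ M hMN => ?_⟩
  have hY : 0 < Y := lt_trans (by have := hN.pos; positivity) hY₁
  rw [div_lt_iff₀ (by positivity)] at hY₁
  rw [lt_div_iff₀ (by positivity)] at hY₂
  have key := int_mul_sub_gt (d := (M : ℤ) - N) (c := δ * γ)
    (t := 2 * (Y * (2 * α)) - 2 * N - 1) (by omega) hc0 (by linarith) (by linarith)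
  push_cast at key
  have hgN : g Y N = (-2 * (Y * (2 * α)) * N + 2 * (δ * γ) + N * (N + 1)) / (2 * Y) := by
    rw [hg, if_neg (Nat.not_even_iff_odd.mpr hN)]
    field_simp
  have hgM : (-2 * (Y * (2 * α)) * M + M * (M + 1)) / (2 * Y) ≤ g Y M := by
    have h : (-2 * (Y * (2 * α)) * M + M * (M + 1)) / (2 * Y)
        = -2 * α * M + M * (M + 1) / (2 * Y) := by
      field_simp
    have hp : 0 ≤ δ * γ / Y := by positivity
    rw [h, hg]
    split_ifs <;> linarith
  refine lt_of_lt_of_le ?_ hgM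
  rw [hgN, div_lt_div_iff_of_pos_right (by positivity)]
  linarith
end

section
/- Assume 0 ≤ δγ < 1/2 and let N ∈ ℕ be odd. Then N is the unique minimizer of g over ℕ (i.e. g(N) < g(M) for all M ≠ N) if and only if (N+δγ)/(2α) < Y < (N+1−δγ)/(2α). -/
/-- For `0 ≤ δγ < 1/2` and `N` odd, `N` is the unique minimizer of `g` over `ℕ`
if and only if `(N+δγ)/(2α) < Y < (N+1−δγ)/(2α)`. -/
theorem stmt_6 (α γ δ Y : ℝ) (hα : 0 < α) (hγ : 0 < γ) (hδ : 0 ≤ δ) (hY : 0 < Y)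
    (hδγ : δ*γ < 1/2)
    (g : ℕ → ℝ)
    (hg : ∀ N : ℕ, g N = if Even N then -2*α*N + N*(N+1)/(2*Y)
      else -2*α*N + δ*γ/Y + N*(N+1)/(2*Y))
    (N : ℕ) (hN : Odd N) :
    (∀ M : ℕ, M ≠ N → g N < g M) ↔
      (((N : ℝ) + δ*γ)/(2*α) < Y ∧ Y < ((N : ℝ) + 1 - δ*γ)/(2*α)) := by
  have hε : 0 ≤ δ * γ := mul_nonneg hδ hγ.le
  have scaled_even : ∀ M : ℕ, Even M → 2 * Y * g M = -2 * (Y * (2 * α)) * M + M * (M + 1) := by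
    intro M hM
    rw [hg, if_pos hM]
    field_simp
  have scaled_odd : ∀ M : ℕ, Odd M →
      2 * Y * g M = -2 * (Y * (2 * α)) * M + 2 * (δ * γ) + M * (M + 1) := by
    intro M hM
    rw [hg, if_neg (Nat.not_even_iff_odd.mpr hM)]
    field_simp
  have lt_iff_scaled : ∀ M : ℕ, g N < g M ↔ 2 * Y * g N < 2 * Y * g M := fun M =>
    (mul_lt_mul_iff_right₀ (by positivity)).symm
  rw [div_lt_iff₀ (by positivity), lt_div_iff₀ (by positivity)]
  simp only [lt_iff_scaled]
  rw [scaled_odd N hN]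
  generalize Y * (2 * α) = a at *
  generalize δ * γ = ε at *
  constructor
  · intro h
    obtain ⟨n, rfl⟩ := hN
    have below := h (2 * n) (by omega)
    have above := h (2 * n + 2) (by omega)
    rw [scaled_even _ (by simp)] at below
    rw [scaled_even _ (by simp [parity_simps])] at above
    push_cast at *
    constructor <;> linarith
  · rintro ⟨hl, hu⟩ M hMN
    have even_bound : -2 * a * N + 2 * ε + N * (N + 1) < -2 * a * M + (M : ℝ) * (M + 1) := by
      rcases lt_or_gt_of_ne hMN with hlt | hlt
      · have : (M : ℝ) + 1 ≤ N := by exact_mod_cast hlt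
        nlinarith
      · have : (N : ℝ) + 1 ≤ M := by exact_mod_cast hlt
        nlinarith
    rcases Nat.even_or_odd M with hM | hM
    · rwa [scaled_even M hM]
    · rw [scaled_odd M hM]
      linarith
end

section
/- Let C = min{δγ, 1/2} and let N ∈ ℕ be even. Then N is the unique minimizer of g over ℕ (i.e. g(N) < g(M) for all M ≠ N) if and only if (N−C)/(2α) < Y < (N+1+C)/(2α) (for N = 0 the left inequality is automatic since Y > 0). -/
/-- For `C = min{δγ, 1/2}` and `N` even, `N` is the unique minimizer of `g` over `ℕ`
if and only if `(N−C)/(2α) < Y < (N+1+C)/(2α)`. -/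
theorem stmt_7 (α γ δ Y : ℝ) (hα : 0 < α) (hγ : 0 < γ) (hδ : 0 ≤ δ) (hY : 0 < Y)
    (g : ℕ → ℝ)
    (hg : ∀ N : ℕ, g N = if Even N then -2*α*N + N*(N+1)/(2*Y)
      else -2*α*N + δ*γ/Y + N*(N+1)/(2*Y))
    (N : ℕ) (hN : Even N) :
    (∀ M : ℕ, M ≠ N → g N < g M) ↔
      (((N : ℝ) - min (δ*γ) (1/2))/(2*α) < Y ∧
        Y < ((N : ℝ) + 1 + min (δ*γ) (1/2))/(2*α)) := by
  have key : ∀ M : ℕ, g N < g M ↔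
      0 < ((M : ℝ) - N) * (M + N + 1 - 2 * (Y * (2 * α))) + if Even M then 0 else 2 * (δ * γ) := by
    intro M
    have h : ((M : ℝ) - N) * (M + N + 1 - 2 * (Y * (2 * α))) +
        (if Even M then 0 else 2 * (δ * γ)) = 2 * Y * (g M - g N) := by
      rw [hg M, hg N, if_pos hN]
      split_ifs <;> field_simp <;> ring
    rw [h, mul_pos_iff_of_pos_left (by positivity), sub_pos]
  have hd : 0 ≤ δ * γ := by positivity
  rw [div_lt_iff₀ (by positivity), lt_div_iff₀ (by positivity)]
  simp only [key]
  have hx : 0 < Y * (2 * α) := by positivity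
  generalize Y * (2 * α) = x at hx
  generalize δ * γ = d at hd
  constructor
  · intro h
    have h1 := h (N + 1) (by omega)
    have h2 := h (N + 2) (by omega)
    rw [if_neg (by grind)] at h1
    rw [if_pos (by grind)] at h2
    push_cast at h1 h2
    refine ⟨?_, ?_⟩
    · rcases Nat.eq_zero_or_pos N with rfl | hpos
      · have : 0 ≤ min d (1 / 2) := le_min hd (by norm_num)
        push_cast
        linarith
      · obtain ⟨K, rfl⟩ : ∃ K, N = K + 2 := ⟨N - 2, by grind⟩
        have h3 := h (K + 1) (by omega)
        have h4 := h K (by omega)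
        rw [if_neg (by grind)] at h3
        rw [if_pos (by grind)] at h4
        push_cast at h3 h4 ⊢
        rcases min_choice d (1 / 2) with e | e <;> rw [e] <;> linarith
    · rcases min_choice d (1 / 2) with e | e <;> rw [e] <;> linarith
  · rintro ⟨hl, hu⟩ M hM
    have hCd := min_le_left d (1 / 2)
    have hCh := min_le_right d (1 / 2)
    have hite : 0 ≤ if Even M then 0 else 2 * d := by split_ifs <;> linarith
    obtain rfl | rfl | hM' | hM' : M = N + 1 ∨ N = M + 1 ∨ N + 2 ≤ M ∨ M + 2 ≤ N := by omega
    · rw [if_neg (by grind)]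
      push_cast
      linarith
    · rw [if_neg (by grind)]
      push_cast at hl hu ⊢
      linarith
    · have hc : (N : ℝ) + 2 ≤ M := by exact_mod_cast hM'
      have := mul_pos (a := (M : ℝ) - N) (b := M + N + 1 - 2 * x) (by linarith) (by linarith)
      linarith
    · have hc : (M : ℝ) + 2 ≤ N := by exact_mod_cast hM'
      have := mul_pos_of_neg_of_neg (a := (M : ℝ) - N) (b := M + N + 1 - 2 * x)
        (by linarith) (by linarith)
      linarith
end

section
/- Effective pinning threshold: let L > 0 and set Y = γ/L. Then 0 is the unique minimizer of g over ℕ (i.e. g(N) > g(0) = 0 for all N ≥ 1) if and only if L > L̄_δ, where L̄_δ = max{2αγ/(δγ+1), 4αγ/3}. -/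
/-- Effective pinning threshold: with `Y = γ/L`, `0` is the unique minimizer of `g`
over `ℕ` (i.e. `g(N) > g(0) = 0` for all `N ≥ 1`) if and only if `L > L̄_δ`, where
`L̄_δ = max{2αγ/(δγ+1), 4αγ/3}`. -/
theorem stmt_8 (α γ δ L : ℝ) (hα : 0 < α) (hγ : 0 < γ) (hδ : 0 ≤ δ) (hL : 0 < L)
    (g : ℕ → ℝ)
    (hg : ∀ N : ℕ, g N = if Even N then -2*α*N + N*(N+1)/(2*(γ/L))
      else -2*α*N + δ*γ/(γ/L) + N*(N+1)/(2*(γ/L))) :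
    g 0 = 0 ∧
    ((∀ N : ℕ, 1 ≤ N → g 0 < g N) ↔ max (2*α*γ/(δ*γ+1)) (4*α*γ/3) < L) := by
  have hγ0 : γ ≠ 0 := hγ.ne'
  have hL0 : L ≠ 0 := hL.ne'
  have hδγ : 0 < δ * γ + 1 := by positivity
  have even_eq : ∀ N : ℕ, Even N → g N = N / (2 * γ) * ((N + 1) * L - 4 * α * γ) := by
    intro N hN
    rw [hg, if_pos hN]
    field_simp
    ring
  have odd_eq : ∀ N : ℕ, ¬ Even N →
      g N = δ * L + N / (2 * γ) * ((N + 1) * L - 4 * α * γ) := by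
    intro N hN
    rw [hg, if_neg hN]
    field_simp
    ring
  have g_zero : g 0 = 0 := by simp [hg]
  have g_one : g 1 = (L * (δ * γ + 1) - 2 * α * γ) / γ := by
    rw [odd_eq 1 (by decide)]
    push_cast
    field_simp
    ring
  have g_two : g 2 = (3 * L - 4 * α * γ) / γ := by
    rw [even_eq 2 (by decide)]
    push_cast
    field_simp
    ring
  refine ⟨g_zero, ?_⟩
  rw [g_zero, max_lt_iff, div_lt_iff₀ hδγ, div_lt_iff₀ (by norm_num : (0 : ℝ) < 3)]
  constructor
  · intro h
    have h₁ := h 1 le_rfl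
    have h₂ := h 2 one_le_two
    rw [g_one, div_pos_iff_of_pos_right hγ] at h₁
    rw [g_two, div_pos_iff_of_pos_right hγ] at h₂
    constructor <;> linarith
  · rintro ⟨h₁, h₂⟩ N hN
    obtain rfl | hN2 := hN.eq_or_lt
    · rw [g_one]
      exact div_pos (by linarith) hγ
    · have hN' : (2 : ℝ) ≤ N := by exact_mod_cast hN2
      have hpos : 0 < N / (2 * γ) * ((N + 1) * L - 4 * α * γ) :=
        mul_pos (by positivity) (by nlinarith)
      by_cases he : Even N
      · rwa [even_eq N he]
      · rw [odd_eq N he]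
        positivity
end

section
/- Suppose δγ ≥ 1/2. Then for every Y > 0 with Y ∉ S_δ, the unique minimizer of g over ℕ equals 2⌊αY + 1/4⌋ (the high-contrast velocity formula). -/
/-- If the shift `u` lies strictly between `-1` and `3`, then moving a nonzero integer distance `d`
away from the base point increases the quadratic `d * (d + 1 - u)`, provided odd moves pay an
extra cost of `1`. -/
lemma quadratic_increment_pos {u : ℝ} (hu : -1 < u) (hu' : u < 3) {d : ℤ} (hd : d ≠ 0) :
    0 < (d : ℝ) * (d + 1 - u) + if Even d then 0 else 1 := by
  have hcases : d = 1 ∨ d = -1 ∨ 2 ≤ d ∨ d ≤ -2 := by omega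
  have hite : (0 : ℝ) ≤ if Even d then 0 else 1 := by split_ifs <;> norm_num
  rcases hcases with rfl | rfl | h | h
  · rw [if_neg (by decide)]; push_cast; linarith
  · rw [if_neg (by decide)]; push_cast; linarith
  · have h' : (2 : ℝ) ≤ d := by exact_mod_cast h
    have := mul_pos (show (0 : ℝ) < d by linarith) (show (0 : ℝ) < d + 1 - u by linarith)
    linarith
  · have h' : (d : ℝ) ≤ -2 := by exact_mod_cast h
    have := mul_pos_of_neg_of_neg (show (d : ℝ) < 0 by linarith)
      (show (d : ℝ) + 1 - u < 0 by linarith)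
    linarith

/-- If `δγ ≥ 1/2`, then for every `Y > 0` with `Y ∉ S_δ` the unique minimizer
of `g` over `ℕ` equals `2⌊αY + 1/4⌋`. -/
theorem stmt_9 (α γ δ Y : ℝ) (hα : 0 < α) (hγ : 0 < γ) (hδ : 0 ≤ δ) (hY : 0 < Y)
    (hδγ : 1/2 ≤ δ*γ)
    (g : ℕ → ℝ)
    (hg : ∀ N : ℕ, g N = if Even N then -2*α*N + N*(N+1)/(2*Y)
      else -2*α*N + δ*γ/Y + N*(N+1)/(2*Y))
    (hS : Y ∉ ({x : ℝ | ∃ m : ℤ, x = (2*m + 1 + min (δ*γ) (1/2))/(2*α)} ∪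
      {x : ℝ | ∃ m : ℤ, x = (2*m - min (δ*γ) (1/2))/(2*α)})) :
    ∃ Nstar : ℕ, (Nstar : ℤ) = 2 * ⌊α*Y + 1/4⌋ ∧
      ∀ M : ℕ, M ≠ Nstar → g Nstar < g M := by
  have hαY : 0 < α * Y := mul_pos hα hY
  obtain ⟨k, hk⟩ := Int.eq_ofNat_of_zero_le (Int.floor_nonneg.2 (by linarith : 0 ≤ α*Y + 1/4))
  refine ⟨2 * k, by rw [hk]; push_cast; rfl, fun M hM => ?_⟩
  have hfloor := Int.floor_le (α*Y + 1/4)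
  have hfloor' := Int.lt_floor_add_one (α*Y + 1/4)
  rw [hk, Int.cast_natCast] at hfloor hfloor'
  have hne : (k : ℝ) ≠ α*Y + 1/4 := by
    intro h
    refine hS (Or.inr ⟨k, ?_⟩)
    rw [min_eq_right hδγ, eq_div_iff (by positivity), Int.cast_natCast]
    linarith
  have hlt := lt_of_le_of_ne hfloor hne
  have hpos := quadratic_increment_pos (u := 4 * (α * Y) - 4 * k) (by linarith) (by linarith)
    (d := (M : ℤ) - (2 * k : ℕ)) (by omega)
  have hparity : Even ((M : ℤ) - (2 * k : ℕ)) ↔ Even M := by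
    rw [Int.even_sub, Int.even_coe_nat, Int.even_coe_nat]
    simp
  simp only [hparity] at hpos
  push_cast at hpos
  rw [hg, hg, if_pos (even_two_mul k), ← sub_pos]
  push_cast
  split_ifs at hpos ⊢ with hM'
  · refine lt_of_lt_of_eq (div_pos hpos (by positivity : 0 < 2 * Y)) ?_
    field_simp
    ring
  · refine lt_of_lt_of_le (div_pos hpos (by positivity : 0 < 2 * Y)) ?_
    rw [← sub_nonneg]
    refine le_of_le_of_eq (div_nonneg (sub_nonneg.2 hδγ) hY.le) ?_
    field_simp
    ring
end

section
/- Explicit form of the subcritical velocity function: assume 0 < δγ < 1/2 and let k ∈ ℕ. Then the unique minimizer N* of g over ℕ satisfies: (i) N* = 2k = ⌊2αY⌋ + 1 if Y ∈ ((2k−δγ)/(2α), 2k/(2α)) (with k ≥ 1); (ii) N* = 2k = ⌊2αY⌋ if Y ∈ (2k/(2α), (2k+1)/(2α)); (iii) N* = 2k = ⌊2αY⌋ − 1 if Y ∈ ((2k+1)/(2α), (2k+1+δγ)/(2α)); (iv) N* = 2k+1 = ⌊2αY⌋ if Y ∈ ((2k+1+δγ)/(2α), (2k+2−δγ)/(2α)).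 -/
/-- The quadratic `d (d + 1 - 2 u)`, perturbed by `2 e` at odd `d`, is positive at every nonzero
integer `d` when `u` lies in `(-e, 1 + e)`. -/
theorem int_quadratic_add_parity_pos {e u : ℝ} (he : |e| < 1/2) (hu : -e < u) (hu' : u < 1 + e)
    {d : ℤ} (hd : d ≠ 0) :
    0 < (d : ℝ) * (d + 1 - 2*u) + if Even d then 0 else 2*e := by
  obtain ⟨he₁, he₂⟩ := abs_lt.mp he
  obtain rfl | rfl | h | h : d = 1 ∨ d = -1 ∨ 2 ≤ d ∨ d ≤ -2 := by omega
  · norm_num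
    linarith
  · norm_num
    linarith
  · have hR : (2 : ℝ) ≤ d := by exact_mod_cast h
    split_ifs <;> nlinarith
  · have hR : (d : ℝ) ≤ -2 := by exact_mod_cast h
    split_ifs <;> nlinarith

/-- A sufficient condition for `N` to be the strict minimizer of the perturbed quadratic `g`,
where the sign of the perturbation `s` depends on the parity of `N`. -/
theorem strict_min_of_mem_window {α s Y : ℝ} (hY : 0 < Y) {g : ℕ → ℝ}
    (hg : ∀ N : ℕ, g N = if Even N then -2*α*N + N*(N+1)/(2*Y)
      else -2*α*N + s/Y + N*(N+1)/(2*Y))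
    (hs : |s| < 1/2) (N : ℕ)
    (hlo : -(if Even N then s else -s) < 2*α*Y - N)
    (hhi : 2*α*Y - N < 1 + if Even N then s else -s) :
    ∀ M : ℕ, M ≠ N → g N < g M := by
  intro M hM
  have he : |if Even N then s else -s| < 1/2 := by
    split_ifs <;> simpa using hs
  have key := int_quadratic_add_parity_pos he hlo hhi
    (sub_ne_zero.mpr (Int.ofNat_inj.not.mpr hM))
  have hgap : g M - g N = (((M : ℤ) - N : ℤ) * ((((M : ℤ) - N : ℤ) : ℝ) + 1 - 2*(2*α*Y - N)) +
      if Even ((M : ℤ) - N) then 0 else 2*(if Even N then s else -s)) / (2*Y) := by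
    rw [hg, hg]
    by_cases h₁ : Even M <;> by_cases h₂ : Even N <;>
      simp [h₁, h₂, Int.even_sub] <;> field_simp <;> ring
  exact sub_pos.mp (hgap ▸ div_pos key (by positivity))


/-- Explicit form of the subcritical velocity function for `0 < δγ < 1/2`. -/
theorem stmt_11 (α γ δ Y : ℝ) (hα : 0 < α) (hγ : 0 < γ) (hY : 0 < Y)
    (hδγpos : 0 < δ*γ) (hδγ : δ*γ < 1/2)
    (g : ℕ → ℝ)
    (hg : ∀ N : ℕ, g N = if Even N then -2*α*N + N*(N+1)/(2*Y)
      else -2*α*N + δ*γ/Y + N*(N+1)/(2*Y)) :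
    ∀ k : ℕ,
      (1 ≤ k → (2*(k : ℝ) - δ*γ)/(2*α) < Y → Y < (2*(k : ℝ))/(2*α) →
        ∃ Nstar : ℕ, (∀ M : ℕ, M ≠ Nstar → g Nstar < g M) ∧
          Nstar = 2*k ∧ (Nstar : ℤ) = ⌊2*α*Y⌋ + 1) ∧
      ((2*(k : ℝ))/(2*α) < Y → Y < (2*(k : ℝ) + 1)/(2*α) →
        ∃ Nstar : ℕ, (∀ M : ℕ, M ≠ Nstar → g Nstar < g M) ∧
          Nstar = 2*k ∧ (Nstar : ℤ) = ⌊2*α*Y⌋) ∧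
      ((2*(k : ℝ) + 1)/(2*α) < Y → Y < (2*(k : ℝ) + 1 + δ*γ)/(2*α) →
        ∃ Nstar : ℕ, (∀ M : ℕ, M ≠ Nstar → g Nstar < g M) ∧
          Nstar = 2*k ∧ (Nstar : ℤ) = ⌊2*α*Y⌋ - 1) ∧
      ((2*(k : ℝ) + 1 + δ*γ)/(2*α) < Y → Y < (2*(k : ℝ) + 2 - δ*γ)/(2*α) →
        ∃ Nstar : ℕ, (∀ M : ℕ, M ≠ Nstar → g Nstar < g M) ∧
          Nstar = 2*k + 1 ∧ (Nstar : ℤ) = ⌊2*α*Y⌋) := by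
  intro k
  have h2α : 0 < 2*α := by linarith
  have hs : |δ*γ| < 1/2 := by rwa [abs_of_pos hδγpos]
  have even_min (h₁ : 2*(k : ℝ) - δ*γ < Y*(2*α)) (h₂ : Y*(2*α) < 2*(k : ℝ) + 1 + δ*γ) :
      ∀ M : ℕ, M ≠ 2*k → g (2*k) < g M := by
    apply strict_min_of_mem_window hY hg hs <;>
      rw [if_pos (even_two_mul k)] <;> push_cast <;> linarith
  have odd_min (h₁ : 2*(k : ℝ) + 1 + δ*γ < Y*(2*α)) (h₂ : Y*(2*α) < 2*(k : ℝ) + 2 - δ*γ) :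
      ∀ M : ℕ, M ≠ 2*k + 1 → g (2*k + 1) < g M := by
    apply strict_min_of_mem_window hY hg hs <;>
      rw [if_neg (Nat.not_even_two_mul_add_one k)] <;> push_cast <;> linarith
  simp only [div_lt_iff₀ h2α, lt_div_iff₀ h2α]
  refine ⟨fun _ h₁ h₂ => ⟨2*k, even_min (by linarith) (by linarith), rfl, ?_⟩,
    fun h₁ h₂ => ⟨2*k, even_min (by linarith) (by linarith), rfl, ?_⟩,
    fun h₁ h₂ => ⟨2*k, even_min (by linarith) (by linarith), rfl, ?_⟩,
    fun h₁ h₂ => ⟨2*k + 1, odd_min (by linarith) (by linarith), rfl, ?_⟩⟩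
  · rw [← sub_eq_iff_eq_add, eq_comm, Int.floor_eq_iff]
    push_cast
    constructor <;> linarith
  · rw [eq_comm, Int.floor_eq_iff]
    push_cast
    constructor <;> linarith
  · rw [eq_sub_iff_add_eq, eq_comm, Int.floor_eq_iff]
    push_cast
    constructor <;> linarith
  · rw [eq_comm, Int.floor_eq_iff]
    push_cast
    constructor <;> linarith
end

section
/- Monotonicity of the effective velocity: if 0 < Y₁ < Y₂, Y₁ ∉ S_δ, Y₂ ∉ S_δ, and N₁, N₂ are the unique minimizers over ℕ of g_{Y₁} and g_{Y₂} respectively, then N₁ ≤ N₂. -/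
/-- Monotonicity of the effective velocity: if `0 < Y₁ < Y₂` both lie outside the
singular set and `N₁, N₂` are the corresponding unique minimizers, then `N₁ ≤ N₂`. -/
theorem stmt_12 (α γ δ : ℝ) (hα : 0 < α) (hγ : 0 < γ) (hδ : 0 ≤ δ)
    (g : ℝ → ℕ → ℝ)
    (hg : ∀ Y : ℝ, ∀ N : ℕ, g Y N = if Even N then -2*α*N + N*(N+1)/(2*Y)
      else -2*α*N + δ*γ/Y + N*(N+1)/(2*Y))
    (Y₁ Y₂ : ℝ) (hY₁ : 0 < Y₁) (hY₁₂ : Y₁ < Y₂)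
    (hS₁ : Y₁ ∉ ({x : ℝ | ∃ m : ℤ, x = (2*m + 1 + min (δ*γ) (1/2))/(2*α)} ∪
      {x : ℝ | ∃ m : ℤ, x = (2*m - min (δ*γ) (1/2))/(2*α)}))
    (hS₂ : Y₂ ∉ ({x : ℝ | ∃ m : ℤ, x = (2*m + 1 + min (δ*γ) (1/2))/(2*α)} ∪
      {x : ℝ | ∃ m : ℤ, x = (2*m - min (δ*γ) (1/2))/(2*α)}))
    (N₁ N₂ : ℕ)
    (hN₁ : ∀ M : ℕ, M ≠ N₁ → g Y₁ N₁ < g Y₁ M)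
    (hN₂ : ∀ M : ℕ, M ≠ N₂ → g Y₂ N₂ < g Y₂ M) :
    N₁ ≤ N₂ := by
  by_contra! hlt
  let h : ℕ → ℝ := fun N => (if Even N then 0 else δ * γ) + N * (N + 1) / 2
  have hmul : ∀ Y : ℝ, 0 < Y → ∀ N : ℕ, Y * g Y N = -2 * α * Y * N + h N := by
    intro Y hY N
    rw [hg]
    simp only [h]
    split_ifs <;> field_simp <;> ring
  have h₁ := mul_lt_mul_of_pos_left (hN₁ N₂ hlt.ne) hY₁
  have h₂ := mul_lt_mul_of_pos_left (hN₂ N₁ hlt.ne') (hY₁.trans hY₁₂)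
  rw [hmul Y₁ hY₁, hmul Y₁ hY₁] at h₁
  rw [hmul Y₂ (hY₁.trans hY₁₂), hmul Y₂ (hY₁.trans hY₁₂)] at h₂
  have hN : (0 : ℝ) < N₁ - N₂ := sub_pos.mpr (Nat.cast_lt.mpr hlt)
  have hpos : 0 < α * ((Y₂ - Y₁) * (N₁ - N₂)) :=
    mul_pos hα (mul_pos (sub_pos.mpr hY₁₂) hN)
  linarith
end

section
/- Large-γ limit of the effective velocity: fix L > 0, α > 0, δ ≥ 0, and for each γ > 0 let N(γ) ∈ ℕ be any minimizer over ℕ of the function g_γ defined with Y = γ/L. Then N(γ)/γ → 2α/L as γ → +∞. -/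
/-- Large-`γ` limit of the effective velocity: with `Y = γ/L`, any choice of
minimizers `N(γ)` of `g_γ` satisfies `N(γ)/γ → 2α/L` as `γ → +∞`. -/
theorem stmt_13 (α δ L : ℝ) (hα : 0 < α) (hδ : 0 ≤ δ) (hL : 0 < L)
    (g : ℝ → ℕ → ℝ)
    (hg : ∀ γ : ℝ, ∀ N : ℕ, g γ N = if Even N then -2*α*N + N*(N+1)/(2*(γ/L))
      else -2*α*N + δ*γ/(γ/L) + N*(N+1)/(2*(γ/L)))
    (N : ℝ → ℕ)
    (hN : ∀ γ : ℝ, 0 < γ → ∀ M : ℕ, g γ (N γ) ≤ g γ M) :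
    Filter.Tendsto (fun γ : ℝ => (N γ : ℝ)/γ) Filter.atTop (nhds (2*α/L)) := by
  have step : ∀ γ : ℝ, 0 < γ → ∀ n : ℕ,
      g γ (n + 2) - g γ n = -4 * α + (2 * n + 3) * L / γ := by
    intro γ hγ n
    have hparity : Even (n + 2) ↔ Even n := by simp [Nat.even_add]
    rw [hg, hg]
    by_cases hn : Even n
    · rw [if_pos (hparity.2 hn), if_pos hn]
      push_cast
      field_simp
      ring
    · rw [if_neg (hparity.not.2 hn), if_neg hn]
      push_cast
      field_simp
      ring
  have lower : ∀ γ : ℝ, 0 < γ → 2 * α / L - 2 / γ ≤ (N γ : ℝ) / γ := by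
    intro γ hγ
    have h : 0 ≤ -4 * α + (2 * N γ + 3) * L / γ := by
      rw [← step γ hγ]
      exact sub_nonneg.2 (hN γ hγ _)
    have h' : 4 * α * γ ≤ (2 * N γ + 3) * L := by
      rw [← le_div_iff₀ hγ]
      linarith
    rw [sub_le_iff_le_add, ← add_div, div_le_div_iff₀ hL hγ]
    linarith
  have upper : ∀ γ : ℝ, 0 < γ → (N γ : ℝ) / γ ≤ 2 * α / L + 2 / γ := by
    intro γ hγ
    rw [← sub_le_iff_le_add, ← sub_div, div_le_div_iff₀ hγ hL]
    rcases lt_or_ge (N γ) 2 with hlt | hge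
    · have hle : (N γ : ℝ) - 2 ≤ 0 := by
        rw [sub_nonpos]
        exact_mod_cast hlt.le
      exact (mul_nonpos_of_nonpos_of_nonneg hle hL.le).trans (by positivity)
    · obtain ⟨m, hm⟩ := Nat.exists_eq_add_of_le' hge
      have h : -4 * α + (2 * m + 3) * L / γ ≤ 0 := by
        rw [← step γ hγ, ← hm]
        exact sub_nonpos.2 (hN γ hγ _)
      have h' : (2 * m + 3) * L ≤ 4 * α * γ := by
        rw [← div_le_iff₀ hγ]
        linarith
      rw [hm]
      push_cast
      linarith
  have hzero : Filter.Tendsto (fun γ : ℝ => 2 / γ) Filter.atTop (nhds 0) :=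
    tendsto_const_nhds.div_atTop Filter.tendsto_id
  refine tendsto_of_tendsto_of_tendsto_of_le_of_le'
    (g := fun γ : ℝ => 2 * α / L - 2 / γ) (h := fun γ : ℝ => 2 * α / L + 2 / γ) ?_ ?_ ?_ ?_
  · simpa using hzero.const_sub (2 * α / L)
  · simpa using hzero.const_add (2 * α / L)
  · filter_upwards [Filter.eventually_gt_atTop 0] with γ hγ using lower γ hγ
  · filter_upwards [Filter.eventually_gt_atTop 0] with γ hγ using upper γ hγ
end

section
/- K-layer uniqueness outside the singular set: if Y > 0 and Y ∉ S, then g has a unique minimizer over ℕ, i.e. there exists N* ∈ ℕ with g(N*) < g(M) for all M ∈ ℕ, M ≠ N*. -/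
/-- The quadratic energy `N² + N - 2tN` perturbed by a penalty `2 c N`. -/
noncomputable def layerEnergy (t : ℝ) (c : ℕ → ℝ) (N : ℕ) : ℝ :=
  (N : ℝ) * (N + 1) - 2 * t * N + 2 * c N

theorem layerEnergy_exists_minimizer (t : ℝ) (c : ℕ → ℝ) (hc : ∀ N, 0 ≤ c N) (hc0 : c 0 = 0) :
    ∃ N, ∀ M, layerEnergy t c N ≤ layerEnergy t c M := by
  obtain ⟨B, hB⟩ := exists_nat_ge (2 * t)
  obtain ⟨N, -, hN⟩ := Finset.exists_min_image (Finset.range (B + 1)) (layerEnergy t c)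
    ⟨0, by simp⟩
  refine ⟨N, fun M => ?_⟩
  by_cases hM : M ∈ Finset.range (B + 1)
  · exact hN M hM
  · have hBM : (B : ℝ) ≤ M := by
      have : B ≤ M := by
        rw [Finset.mem_range] at hM
        omega
      exact_mod_cast this
    have h0 : layerEnergy t c N ≤ 0 := by
      simpa [layerEnergy, hc0] using hN 0 (by simp)
    have hM0 : (0 : ℝ) ≤ M * (M + 1 - 2 * t) := mul_nonneg (by positivity) (by linarith)
    have := hc M
    unfold layerEnergy
    unfold layerEnergy at h0
    linarith

section Minimizer

variable {t : ℝ} {c : ℕ → ℝ} {N : ℕ}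

theorem two_mul_le_of_even_minimizer (hc : ∀ N, Even N → c N = 0) (hN : Even N)
    (h : ∀ M, layerEnergy t c N ≤ layerEnergy t c M) : 2 * t ≤ 2 * N + 3 := by
  have h2 := h (N + 2)
  simp only [layerEnergy, hc N hN, hc (N + 2) (hN.add even_two)] at h2
  push_cast at h2
  linarith

theorem le_two_mul_of_even_minimizer (hc : ∀ N, Even N → c N = 0) (hN : Even (N + 2))
    (h : ∀ M, layerEnergy t c (N + 2) ≤ layerEnergy t c M) : 2 * (N : ℝ) + 3 ≤ 2 * t := by
  have h2 := h N
  simp only [layerEnergy, hc N (by grind), hc (N + 2) hN] at h2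
  push_cast at h2
  linarith

theorem le_of_odd_minimizer (hc : ∀ N, Even N → c N = 0) (hN : Odd N)
    (h : ∀ M, layerEnergy t c N ≤ layerEnergy t c M) : t ≤ N + 1 - c N := by
  have h2 := h (N + 1)
  simp only [layerEnergy, hc (N + 1) hN.add_one] at h2
  push_cast at h2
  linarith

theorem ge_of_odd_minimizer (hc : ∀ N, Even N → c N = 0) (hN : Odd N)
    (h : ∀ M, layerEnergy t c N ≤ layerEnergy t c M) : N + c N ≤ t := by
  obtain ⟨k, rfl⟩ := hN
  have h2 := h (2 * k)
  simp only [layerEnergy, hc (2 * k) (even_two_mul k)] at h2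
  push_cast at h2 ⊢
  linarith

end Minimizer

/-- Two distinct minimizers force `t` to be one of the transition values. -/
theorem layerEnergy_not_two_minimizers {t : ℝ} {c : ℕ → ℝ} (hc0 : ∀ N, 0 ≤ c N)
    (hc : ∀ N, Even N → c N = 0)
    (ht₁ : ∀ N : ℕ, Odd N → t ≠ N + min (c N) (1 / 2))
    (ht₂ : ∀ N : ℕ, Odd N → t ≠ N + 1 - min (c N) (1 / 2))
    {N M : ℕ} (hNM : N < M) (hN : ∀ L, layerEnergy t c N ≤ layerEnergy t c L)
    (hM : ∀ L, layerEnergy t c M ≤ layerEnergy t c L) : False := by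
  rcases Nat.even_or_odd N with eN | oN <;> rcases Nat.even_or_odd M with eM | oM
  · obtain ⟨L, rfl⟩ : ∃ L, M = L + 2 := ⟨M - 2, by grind⟩
    have h1 := two_mul_le_of_even_minimizer hc eN hN
    have h2 := le_two_mul_of_even_minimizer hc eM hM
    have hLN : L = N := by
      have : (L : ℝ) ≤ N := by linarith
      have : L ≤ N := by exact_mod_cast this
      grind
    subst hLN
    have h3 := hN (L + 1)
    simp only [layerEnergy, hc L eN] at h3
    push_cast at h3
    have h4 := ht₁ (L + 1) eN.add_one
    rw [min_eq_right (by linarith)] at h4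
    push_cast at h4
    exact h4 (by linarith)
  · have h1 := two_mul_le_of_even_minimizer hc eN hN
    have h2 := le_of_odd_minimizer hc oM hM
    have h3 := ge_of_odd_minimizer hc oM hM
    have h0 := hc0 M
    have hMN : M = N + 1 := by
      have : (M : ℝ) < N + 2 := by linarith
      have : M < N + 2 := by exact_mod_cast this
      omega
    subst hMN
    have h4 := ht₁ (N + 1) oM
    rw [min_eq_left (by linarith)] at h4
    have h5 := hN (N + 1)
    have h6 := hM N
    simp only [layerEnergy, hc N eN] at h5 h6
    push_cast at h4 h5 h6
    exact h4 (by linarith)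
  · obtain ⟨L, rfl⟩ : ∃ L, M = L + 2 := ⟨M - 2, by grind⟩
    have h1 := le_two_mul_of_even_minimizer hc eM hM
    have h2 := le_of_odd_minimizer hc oN hN
    have h3 := ge_of_odd_minimizer hc oN hN
    have h0 := hc0 N
    have hNL : N = L + 1 := by
      have : (L : ℝ) < N := by linarith
      have : L < N := by exact_mod_cast this
      omega
    subst hNL
    have h4 := ht₂ (L + 1) oN
    rw [min_eq_left (by linarith)] at h4
    have h5 := hN (L + 2)
    have h6 := hM (L + 1)
    simp only [layerEnergy, hc (L + 2) eM] at h5 h6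
    push_cast at h4 h5 h6
    exact h4 (by linarith)
  · have h1 := le_of_odd_minimizer hc oN hN
    have h2 := ge_of_odd_minimizer hc oM hM
    have h3 := hc0 N
    have h4 := hc0 M
    have : (N : ℝ) + 2 ≤ M := by
      have : N + 2 ≤ M := by grind
      exact_mod_cast this
    linarith

/-- Every odd `N` is `2Km + 2r - 1` with `r = (N % (2K) + 1) / 2 ∈ {1, …, K}`. -/
theorem odd_layer_index {K N : ℕ} (hK : 1 ≤ K) (hN : Odd N) :
    (N % (2 * K) + 1) / 2 ∈ Finset.Icc 1 K ∧
      2 * K * (N / (2 * K)) + 2 * ((N % (2 * K) + 1) / 2) = N + 1 := by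
  have h1 := Nat.div_add_mod N (2 * K)
  have h2 := Nat.mod_lt N (show 0 < 2 * K by omega)
  rw [mul_assoc] at h1 ⊢
  rw [Finset.mem_Icc]
  obtain ⟨k, rfl⟩ := hN
  omega


/-- K-layer uniqueness outside the singular set: if `Y > 0` and `Y ∉ S`, then `g`
has a unique minimizer over `ℕ`. -/
theorem stmt_15 (K : ℕ) (hK : 1 ≤ K) (α γ Y : ℝ)
    (hα : 0 < α) (hγ : 0 < γ) (hY : 0 < Y)
    (δ : ℕ → ℝ) (hδ : ∀ r ∈ Finset.Icc 1 K, 0 ≤ δ r)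
    (g : ℕ → ℝ)
    (hg : ∀ N : ℕ, g N = if Even N then -2*α*N + N*(N+1)/(2*Y)
      else -2*α*N + δ ((N % (2*K) + 1)/2) * γ/Y + N*(N+1)/(2*Y))
    (hS : Y ∉ ({x : ℝ | ∃ m : ℤ, ∃ r ∈ Finset.Icc 1 K,
        x = (2*(K : ℝ)*(m : ℝ) + 2*(r : ℝ) - 1 + min (δ r * γ) (1/2))/(2*α)} ∪
      {x : ℝ | ∃ m : ℤ, ∃ r ∈ Finset.Icc 1 K,
        x = (2*(K : ℝ)*(m : ℝ) + 2*(r : ℝ) - min (δ r * γ) (1/2))/(2*α)})) :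
    ∃ Nstar : ℕ, ∀ M : ℕ, M ≠ Nstar → g Nstar < g M := by
  let c : ℕ → ℝ := fun N => if Even N then 0 else δ ((N % (2 * K) + 1) / 2) * γ
  have hce : ∀ N, Even N → c N = 0 := fun N hN => if_pos hN
  have hco : ∀ N, Odd N → c N = δ ((N % (2 * K) + 1) / 2) * γ := fun N hN =>
    if_neg (Nat.not_even_iff_odd.mpr hN)
  have hc0 : ∀ N, 0 ≤ c N := by
    intro N
    rcases Nat.even_or_odd N with hN | hN
    · exact (hce N hN).ge
    · rw [hco N hN]
      exact mul_nonneg (hδ _ (odd_layer_index hK hN).1) hγ.le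
  have hgc : ∀ N, layerEnergy (2 * α * Y) c N = 2 * Y * g N := by
    intro N
    rw [hg N, layerEnergy]
    rcases Nat.even_or_odd N with hN | hN
    · rw [if_pos hN, hce N hN]
      field_simp
      ring
    · rw [if_neg (Nat.not_even_iff_odd.mpr hN), hco N hN]
      field_simp
      ring
  have hidx : ∀ N : ℕ, Odd N → 2 * (K : ℝ) * ((N / (2 * K) : ℕ) : ℤ)
      + 2 * (((N % (2 * K) + 1) / 2 : ℕ) : ℝ) = N + 1 := by
    intro N hN
    rw [Int.cast_natCast]
    exact_mod_cast (odd_layer_index hK hN).2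
  have ht₁ : ∀ N : ℕ, Odd N → 2 * α * Y ≠ N + min (c N) (1 / 2) := by
    intro N hN h
    refine hS (Or.inl ⟨((N / (2 * K) : ℕ) : ℤ), _, (odd_layer_index hK hN).1, ?_⟩)
    rw [hidx N hN, ← hco N hN, eq_div_iff (by positivity)]
    linarith
  have ht₂ : ∀ N : ℕ, Odd N → 2 * α * Y ≠ N + 1 - min (c N) (1 / 2) := by
    intro N hN h
    refine hS (Or.inr ⟨((N / (2 * K) : ℕ) : ℤ), _, (odd_layer_index hK hN).1, ?_⟩)
    rw [hidx N hN, ← hco N hN, eq_div_iff (by positivity)]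
    linarith
  obtain ⟨N, hN⟩ := layerEnergy_exists_minimizer (2 * α * Y) c hc0 (hce 0 Even.zero)
  refine ⟨N, fun M hMN => ?_⟩
  by_contra! hle
  have hM : ∀ L, layerEnergy (2 * α * Y) c M ≤ layerEnergy (2 * α * Y) c L := fun L =>
    le_trans (by rw [hgc, hgc]; gcongr) (hN L)
  rcases lt_or_gt_of_ne hMN with h | h
  · exact layerEnergy_not_two_minimizers hc0 hce ht₁ ht₂ h hM hN
  · exact layerEnergy_not_two_minimizers hc0 hce ht₁ ht₂ h hN hM
end

section
/- K-layer velocity formula, odd case: let N ∈ ℕ be odd with N ≡ 2r−1 (mod 2K), r ∈ {1,…,K}. If (N+C_r)/(2α) < Y < (N+1−C_r)/(2α), then N is the unique minimizer of g over ℕ (when C_r = 1/2 this interval is empty and the statement is vacuous). -/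
/-- K-layer velocity formula, odd case: if `N` is odd with `N ≡ 2r−1 (mod 2K)` and
`(N+C_r)/(2α) < Y < (N+1−C_r)/(2α)`, then `N` is the unique minimizer of `g`. -/
theorem stmt_16 (K : ℕ) (hK : 1 ≤ K) (α γ Y : ℝ)
    (hα : 0 < α) (hγ : 0 < γ) (hY : 0 < Y)
    (δ : ℕ → ℝ) (hδ : ∀ r ∈ Finset.Icc 1 K, 0 ≤ δ r)
    (g : ℕ → ℝ)
    (hg : ∀ N : ℕ, g N = if Even N then -2*α*N + N*(N+1)/(2*Y)
      else -2*α*N + δ ((N % (2*K) + 1)/2) * γ/Y + N*(N+1)/(2*Y))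
    (N r : ℕ) (hNodd : Odd N) (hr : r ∈ Finset.Icc 1 K)
    (hNr : N % (2*K) = 2*r - 1)
    (h1 : ((N : ℝ) + min (δ r * γ) (1/2))/(2*α) < Y)
    (h2 : Y < ((N : ℝ) + 1 - min (δ r * γ) (1/2))/(2*α)) :
    ∀ M : ℕ, M ≠ N → g N < g M := by
  have hr' := Finset.mem_Icc.mp hr
  have h2α : 0 < 2 * α := by positivity
  rw [div_lt_iff₀ h2α] at h1
  rw [lt_div_iff₀ h2α] at h2
  have hC : min (δ r * γ) (1/2) = δ r * γ := by
    rcases min_choice (δ r * γ) (1/2) with h | h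
    · exact h
    · rw [h] at h1 h2
      linarith
  rw [hC] at h1 h2
  have hd : 0 ≤ δ r * γ := mul_nonneg (hδ r hr) hγ.le
  have hgN : 2 * Y * g N = -2 * (Y * (2 * α)) * N + N * (N + 1) + 2 * (δ r * γ) := by
    have hidx : (N % (2 * K) + 1) / 2 = r := by omega
    rw [hg, if_neg (Nat.not_even_iff_odd.mpr hNodd), hidx]
    field_simp
    ring
  intro M hM
  have hgM : -2 * (Y * (2 * α)) * M + M * (M + 1) ≤ 2 * Y * g M := by
    rw [hg]
    split_ifs with hE
    · apply le_of_eq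
      field_simp
    · have hmem : (M % (2 * K) + 1) / 2 ∈ Finset.Icc 1 K := by
        have hodd : M % (2 * K) % 2 = 1 := by
          rw [Nat.mod_mod_of_dvd _ (dvd_mul_right 2 K)]
          exact Nat.odd_iff.mp (Nat.not_even_iff_odd.mp hE)
        have hlt : M % (2 * K) < 2 * K := Nat.mod_lt _ (by omega)
        rw [Finset.mem_Icc]
        omega
      have hdM : 0 ≤ δ ((M % (2 * K) + 1) / 2) * γ := mul_nonneg (hδ _ hmem) hγ.le
      generalize δ ((M % (2 * K) + 1) / 2) = e at hdM ⊢
      have heq : 2 * Y * (-2 * α * M + e * γ / Y + M * (M + 1) / (2 * Y))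
          = -2 * (Y * (2 * α)) * M + M * (M + 1) + 2 * (e * γ) := by
        field_simp
        ring
      linarith
  refine lt_of_mul_lt_mul_left (a := 2 * Y) ?_ (by positivity)
  refine lt_of_lt_of_le ?_ hgM
  rw [hgN]
  generalize Y * (2 * α) = t at h1 h2
  generalize δ r * γ = d at h1 h2 hd
  rcases lt_or_gt_of_ne hM with h | h
  · obtain ⟨j, rfl⟩ := Nat.exists_eq_add_of_lt h
    push_cast at h1 h2 ⊢
    have hj : (0 : ℝ) ≤ j := Nat.cast_nonneg j
    nlinarith [mul_nonneg hj hj, mul_nonneg hj (sub_nonneg.mpr h1.le), mul_nonneg hj hd]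
  · obtain ⟨j, rfl⟩ := Nat.exists_eq_add_of_lt h
    push_cast
    have hj : (0 : ℝ) ≤ j := Nat.cast_nonneg j
    nlinarith [mul_nonneg hj hj, mul_nonneg hj (sub_nonneg.mpr h2.le), mul_nonneg hj hd]
end

section
/- K-layer velocity formula, even case: let N ∈ ℕ be even, and let r, r' ∈ {1,…,K} be the indices with N−1 ≡ 2r−1 (mod 2K) and N+1 ≡ 2r'−1 (mod 2K) (for N = 0 take r = K). If Y > 0 satisfies (N−C_r)/(2α) < Y < (N+1+C_{r'})/(2α) (for N = 0 the left inequality is automatic since Y > 0), then N is the unique minimizer of g over ℕ. -/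
/-- The layer index attached to an odd integer lies in `{1, …, K}`. -/
lemma layer_index_mem_Icc {K M : ℕ} (hK : 1 ≤ K) (hM : ¬ Even M) :
    (M % (2 * K) + 1) / 2 ∈ Finset.Icc 1 K := by
  have hlt : M % (2 * K) < 2 * K := Nat.mod_lt _ (by omega)
  have hpar : M % (2 * K) % 2 = M % 2 := Nat.mod_mod_of_dvd M (Dvd.intro K rfl)
  rw [Nat.even_iff] at hM
  rw [Finset.mem_Icc]
  omega

/-- Among quadratic energies with nonnegative penalties, the unpenalized integer `n` beats
`m ≠ n` as soon as the slope `t` lies in the window determined by the penalties of the two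
neighbours of `n`. -/
lemma quadratic_penalty_pos {n m : ℕ} {t e a b : ℝ} (he : 0 ≤ e)
    (hlow : (n : ℝ) - min a (1 / 2) < t) (hup : t < n + 1 + min b (1 / 2))
    (ha : m + 1 = n → e = a) (hb : m = n + 1 → e = b) (hmn : m ≠ n) :
    0 < ((m : ℝ) - n) * (m + n + 1 - 2 * t) + 2 * e := by
  have ha₁ := min_le_left a (1 / 2)
  have ha₂ := min_le_right a (1 / 2)
  have hb₁ := min_le_left b (1 / 2)
  have hb₂ := min_le_right b (1 / 2)
  rcases lt_or_gt_of_ne hmn with h | h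
  · by_cases hadj : m + 1 = n
    · have hcast : (n : ℝ) = m + 1 := by exact_mod_cast hadj.symm
      have hea := ha hadj
      rw [hcast] at hlow ⊢
      linarith
    · have hcast : (m : ℝ) + 2 ≤ n := by exact_mod_cast (by omega : m + 2 ≤ n)
      have := mul_pos_of_neg_of_neg (by linarith : (m : ℝ) - n < 0)
        (by linarith : (m : ℝ) + n + 1 - 2 * t < 0)
      linarith
  · by_cases hadj : m = n + 1
    · have hcast : (m : ℝ) = n + 1 := by exact_mod_cast hadj
      have heb := hb hadj
      rw [hcast]
      linarith
    · have hcast : (n : ℝ) + 2 ≤ m := by exact_mod_cast (by omega : n + 2 ≤ m)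
      have := mul_pos (by linarith : 0 < (m : ℝ) - n)
        (by linarith : 0 < (m : ℝ) + n + 1 - 2 * t)
      linarith

/-- K-layer velocity formula, even case: let `N` be even, with `r, r' ∈ {1,…,K}`
such that `N−1 ≡ 2r−1 (mod 2K)` (for `N = 0` take `r = K`) and
`N+1 ≡ 2r'−1 (mod 2K)`. If `(N−C_r)/(2α) < Y < (N+1+C_{r'})/(2α)`, then `N` is the
unique minimizer of `g` over `ℕ`. -/
theorem stmt_17 (K : ℕ) (hK : 1 ≤ K) (α γ Y : ℝ)
    (hα : 0 < α) (hγ : 0 < γ) (hY : 0 < Y)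
    (δ : ℕ → ℝ) (hδ : ∀ r ∈ Finset.Icc 1 K, 0 ≤ δ r)
    (g : ℕ → ℝ)
    (hg : ∀ N : ℕ, g N = if Even N then -2*α*N + N*(N+1)/(2*Y)
      else -2*α*N + δ ((N % (2*K) + 1)/2) * γ/Y + N*(N+1)/(2*Y))
    (N r r' : ℕ) (hNeven : Even N)
    (hr : r ∈ Finset.Icc 1 K) (hr' : r' ∈ Finset.Icc 1 K)
    (hNr : (N = 0 ∧ r = K) ∨ (0 < N ∧ (N - 1) % (2*K) = 2*r - 1))
    (hNr' : (N + 1) % (2*K) = 2*r' - 1)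
    (h1 : ((N : ℝ) - min (δ r * γ) (1/2))/(2*α) < Y)
    (h2 : Y < ((N : ℝ) + 1 + min (δ r' * γ) (1/2))/(2*α)) :
    ∀ M : ℕ, M ≠ N → g N < g M := by
  intro M hMN
  rw [div_lt_iff₀ (by positivity)] at h1
  rw [lt_div_iff₀ (by positivity)] at h2
  rw [Finset.mem_Icc] at hr hr'
  obtain ⟨e, he, hgM, hleft, hright⟩ : ∃ e : ℝ, 0 ≤ e ∧
      g M = -2*α*M + e/Y + M*(M+1)/(2*Y) ∧
      (M + 1 = N → e = δ r * γ) ∧ (M = N + 1 → e = δ r' * γ) := by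
    by_cases hM : Even M
    · refine ⟨0, le_rfl, ?_, ?_, ?_⟩
      · rw [hg, if_pos hM]
        ring
      all_goals
        intro h
        rw [Nat.even_iff] at hM hNeven
        omega
    · refine ⟨δ ((M % (2*K) + 1)/2) * γ,
        mul_nonneg (hδ _ (layer_index_mem_Icc hK hM)) hγ.le, ?_, ?_, ?_⟩
      · rw [hg, if_neg hM]
      · intro h
        rcases hNr with ⟨h0, -⟩ | ⟨-, hmod⟩
        · omega
        · rw [show N - 1 = M by omega] at hmod
          rw [hmod, show (2*r - 1 + 1)/2 = r by omega]
      · intro h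
        rw [h, hNr', show (2*r' - 1 + 1)/2 = r' by omega]
  have hpos := quadratic_penalty_pos he h1 h2 hleft hright hMN
  have hdiff : g M - g N =
      (((M : ℝ) - N) * (M + N + 1 - 2 * (Y * (2*α))) + 2 * e) / (2*Y) := by
    rw [hgM, hg N, if_pos hNeven]
    field_simp
    ring
  rw [← sub_pos, hdiff]
  positivity
end

section
/- K-layer pinning threshold: let δ_min = min{δ_1, …, δ_K}, let L > 0 and set Y = γ/L. If L > max{2αγ/(δ_min γ + 1), 4αγ/3}, then 0 is the unique minimizer of g over ℕ, i.e. g(N) > g(0) = 0 for all N ≥ 1. -/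
/-- K-layer pinning threshold: let `δ_min = min{δ_1, …, δ_K}`, `L > 0`, `Y = γ/L`.
If `L > max{2αγ/(δ_min γ + 1), 4αγ/3}`, then `0` is the unique minimizer of `g`
over `ℕ`, i.e. `g(N) > g(0) = 0` for all `N ≥ 1`. -/
theorem stmt_18 (K : ℕ) (hK : 1 ≤ K) (α γ L : ℝ)
    (hα : 0 < α) (hγ : 0 < γ) (hL : 0 < L)
    (δ : ℕ → ℝ) (hδ : ∀ r ∈ Finset.Icc 1 K, 0 ≤ δ r)
    (δmin : ℝ)
    (hmin1 : ∀ r ∈ Finset.Icc 1 K, δmin ≤ δ r)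
    (hmin2 : ∃ r ∈ Finset.Icc 1 K, δ r = δmin)
    (g : ℕ → ℝ)
    (hg : ∀ N : ℕ, g N = if Even N then -2*α*N + N*(N+1)/(2*(γ/L))
      else -2*α*N + δ ((N % (2*K) + 1)/2) * γ/(γ/L) + N*(N+1)/(2*(γ/L)))
    (hLbig : max (2*α*γ/(δmin*γ+1)) (4*α*γ/3) < L) :
    g 0 = 0 ∧ ∀ N : ℕ, 1 ≤ N → g 0 < g N := by
  have hr : ∀ N : ℕ, ¬ Even N → (N % (2 * K) + 1) / 2 ∈ Finset.Icc 1 K := by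
    intro N hN
    have hlt : N % (2 * K) < 2 * K := Nat.mod_lt _ (by omega)
    have hodd : N % (2 * K) % 2 = N % 2 := Nat.mod_mul_right_mod N 2 K
    rw [Nat.not_even_iff] at hN
    rw [Finset.mem_Icc]
    omega
  have hδmin : 0 ≤ δmin := by
    obtain ⟨r, hrK, rfl⟩ := hmin2
    exact hδ r hrK
  obtain ⟨h1, h2⟩ := max_lt_iff.mp hLbig
  rw [div_lt_iff₀ (by positivity)] at h1
  have hquad : ∀ x : ℝ, x * (x + 1) / (2 * (γ / L)) = x * (x + 1) * L / (2 * γ) := by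
    intro x
    field_simp
  have hdef : ∀ d : ℝ, d * γ / (γ / L) = d * L := by
    intro d
    field_simp
  have hlarge : ∀ N : ℕ, 2 ≤ N → 0 < -2 * α * N + (N : ℝ) * (N + 1) * L / (2 * γ) := by
    intro N hN
    have hN' : (2 : ℝ) ≤ N := by exact_mod_cast hN
    have hpos : 0 < (N : ℝ) * ((N + 1) * L - 4 * α * γ) :=
      mul_pos (by linarith) (by nlinarith)
    have heq : -2 * α * N + (N : ℝ) * (N + 1) * L / (2 * γ)
        = N * ((N + 1) * L - 4 * α * γ) / (2 * γ) := by
      field_simp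
      ring
    rw [heq]
    positivity
  have h0 : g 0 = 0 := by simp [hg]
  refine ⟨h0, fun N hN => ?_⟩
  rw [h0, hg, hquad]
  split_ifs with hE
  · have hne : N ≠ 1 := by
      rintro rfl
      simp at hE
    exact hlarge N (by omega)
  · have hmem := hr N hE
    rw [hdef]
    generalize (N % (2 * K) + 1) / 2 = r at hmem ⊢
    rcases hN.eq_or_lt with rfl | hN
    · have hpos : 0 < L * (δ r * γ + 1) - 2 * α * γ := by
        have := mul_le_mul_of_nonneg_left (hmin1 r hmem) (mul_pos hL hγ).le
        linarith
      have heq : -2 * α * (1 : ℕ) + δ r * L + ((1 : ℕ) : ℝ) * ((1 : ℕ) + 1) * L / (2 * γ)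
          = (L * (δ r * γ + 1) - 2 * α * γ) / γ := by
        push_cast
        field_simp
        ring
      rw [heq]
      positivity
    · have := hlarge N hN
      have := mul_nonneg (hδ r hmem) hL.le
      linarith
end
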